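/- (Explicit form of the length-5 half-relation polynomial.) For every q : ℝ and all integers a₁, a₂, a₃, a₄, a₅, setting M := A^{a₁} * (B q)^{a₂} * A^{a₃} * (B q)^{a₄} * A^{a₅} in SL(2,ℝ), one has q * (M 0 1) - (M 1 0) = q * ( (a₁*a₂*a₃*a₄*a₅) * q^2 + (a₁*a₂*a₃ - a₂*a₃*a₄ + a₁*a₂*a₅ + a₁*a₄*a₅ + a₃*a₄*a₅) * q + (a₁ - a₂ + a₃ - a₄ + a₅) ), where the integer coefficients are coerced to ℝ. -/

import Mathlib

abbrev SL2R := Matrix.SpecialLinearGroup (Fin 2) ℝ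

/-- The matrix `A = [[1,1],[0,1]]` in `SL(2,ℝ)`. -/
def A : SL2R := ⟨!![1,1;0,1], by norm_num [Matrix.det_fin_two_of]⟩

/-- The matrix `B q = [[1,0],[q,1]]` in `SL(2,ℝ)`. -/
def B (q : ℝ) : SL2R := ⟨!![1,0;q,1], by norm_num [Matrix.det_fin_two_of]⟩

theorem coe_A_zpow (n : ℤ) : ((A ^ n : SL2R) : Matrix (Fin 2) (Fin 2) ℝ) = !![1, (n : ℝ); 0, 1] := by
  induction n with
  | zero => simp [Matrix.one_fin_two]
  | succ n ih =>
    rw [zpow_add_one, Matrix.SpecialLinearGroup.coe_mul, ih]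
    simp [A, add_comm]
  | pred n ih =>
    rw [zpow_sub_one, Matrix.SpecialLinearGroup.coe_mul, ih, Matrix.SpecialLinearGroup.coe_inv]
    simp [A, Matrix.adjugate_fin_two]
    ring

theorem coe_B_zpow (q : ℝ) (n : ℤ) :
    ((B q ^ n : SL2R) : Matrix (Fin 2) (Fin 2) ℝ) = !![1, 0; n * q, 1] := by
  induction n with
  | zero => simp [Matrix.one_fin_two]
  | succ n ih =>
    rw [zpow_add_one, Matrix.SpecialLinearGroup.coe_mul, ih]
    simp [B]
    ring
  | pred n ih =>
    rw [zpow_sub_one, Matrix.SpecialLinearGroup.coe_mul, ih, Matrix.SpecialLinearGroup.coe_inv]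
    simp [B, Matrix.adjugate_fin_two]
    ring

/-- Explicit form of the length-5 half-relation polynomial. -/
theorem half_relation_poly_five (q : ℝ) (a₁ a₂ a₃ a₄ a₅ : ℤ) :
    q * ((A ^ a₁ * (B q) ^ a₂ * A ^ a₃ * (B q) ^ a₄ * A ^ a₅) 0 1)
      - ((A ^ a₁ * (B q) ^ a₂ * A ^ a₃ * (B q) ^ a₄ * A ^ a₅) 1 0)
    = q * ((a₁ * a₂ * a₃ * a₄ * a₅ : ℤ) * q ^ 2
        + (a₁ * a₂ * a₃ - a₂ * a₃ * a₄ + a₁ * a₂ * a₅ + a₁ * a₄ * a₅ + a₃ * a₄ * a₅ : ℤ) * q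
        + (a₁ - a₂ + a₃ - a₄ + a₅ : ℤ)) := by
  simp only [Matrix.SpecialLinearGroup.coe_mul, coe_A_zpow, coe_B_zpow, Matrix.mul_fin_two]
  simp
  ring
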